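/- Let f : X → ℂ and q, r : X → (0,∞) be measurable, and let χ : Ω → H be measurable and symmetric. Define the creation operator a*(f)χ : Ω → H by (a*(f)χ)(n, x) = ∑_{i : Fin n} f(x_i) · χ((n, x) ∖ i) (so (a*(f)χ)(0, ·) = 0). Then the creation estimate ∫_Ω ‖(a*(f)χ)(ϑ)‖² ((q + r)⁻¹)^⊗(ϑ) dμ(ϑ) ≤ (∫_X |f|²/r dλ) · ∫_Ω ‖χ(ϑ)‖² (q⁻¹)^⊗(ϑ) dμ(ϑ) holds. -/

import Mathlib

open MeasureTheory ENNReal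
open scoped NNReal

noncomputable section

/-- The Guichardet space over `X`. -/
abbrev GS (X : Type*) := Σ n : ℕ, Fin n → X

/-- The Guichardet measure `μ = ∑ₙ (1/n!)·(Sigma.mk n)_* λ^{⊗n}`. -/
def guichardetMeasure {X : Type*} [MeasurableSpace X] (lam : Measure X) : Measure (GS X) :=
  Measure.sum fun n =>
    ((n.factorial : ℝ≥0∞))⁻¹ • Measure.map (Sigma.mk n) (Measure.pi fun _ : Fin n => lam)

/-- The product weight `q^⊗(n,x) = ∏ᵢ q(xᵢ)`. -/
def prodWeight {X : Type*} (q : X → ℝ≥0) (ϑ : GS X) : ℝ≥0∞ :=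
  ∏ i : Fin ϑ.1, (q (ϑ.2 i) : ℝ≥0∞)

/-- A function on the Guichardet space is symmetric if it is invariant under permutations
of the coordinates. -/
def SymmFun {X E : Type*} (χ : GS X → E) : Prop :=
  ∀ (n : ℕ) (σ : Equiv.Perm (Fin n)) (x : Fin n → X), χ ⟨n, x ∘ σ⟩ = χ ⟨n, x⟩

/-- `ϑ ∖ i`: remove the `i`-th coordinate. -/
def GS.erase {X : Type*} : (ϑ : GS X) → Fin ϑ.1 → GS X
  | ⟨_ + 1, x⟩, i => ⟨_, x ∘ i.succAbove⟩

/-- The creation operator `(a*(f)χ)(n,x) = ∑ᵢ f(xᵢ) • χ((n,x) ∖ i)`. -/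
def creation {X H : Type*} [AddCommMonoid H] [Module ℂ H]
    (f : X → ℂ) (χ : GS X → H) (ϑ : GS X) : H :=
  ∑ i : Fin ϑ.1, f (ϑ.2 i) • χ (ϑ.erase i)

/-- The terms of the expansion of `∏ⱼ (q j + r j)` with exactly one factor `r` are dominated by
the whole product. -/
theorem sum_mul_prod_succAbove_le_prod_add (n : ℕ) (q r : Fin (n + 1) → ℝ≥0) :
    ∑ i, r i * ∏ j, q (i.succAbove j) ≤ ∏ j, (q j + r j) := by
  induction n with
  | zero => simp
  | succ n ih =>
    have h := ih (fun i => q i.succ) (fun i => r i.succ)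
    have hq : ∏ j : Fin (n + 1), q j.succ ≤ ∏ j : Fin (n + 1), (q j.succ + r j.succ) :=
      Finset.prod_le_prod' fun j _ => le_self_add
    rw [Fin.sum_univ_succ, Fin.prod_univ_succ (fun j => q j + r j), add_mul, add_comm]
    refine add_le_add ?_ ?_
    · calc ∑ i : Fin (n + 1), r i.succ * ∏ j, q (i.succ.succAbove j)
          = q 0 * ∑ i : Fin (n + 1), r i.succ * ∏ j, q (i.succAbove j).succ := by
            rw [Finset.mul_sum]
            refine Finset.sum_congr rfl fun i _ => ?_
            rw [Fin.prod_univ_succ]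
            simp only [Fin.succ_succAbove_zero, Fin.succ_succAbove_succ]
            ring
        _ ≤ _ := by gcongr
    · simpa using mul_le_mul_right hq (r 0)

/-- Weighted Cauchy–Schwarz bound for the creation operator on the `(n + 1)`-particle sector. -/
theorem creation_sq_mul_prodWeight_le {X H : Type*} [NormedAddCommGroup H]
    [InnerProductSpace ℂ H] (f : X → ℂ) (q r : X → ℝ≥0) (hq : ∀ x, 0 < q x) (hr : ∀ x, 0 < r x)
    (χ : GS X → H) (n : ℕ) (x : Fin (n + 1) → X) :
    (‖creation f χ ⟨n + 1, x⟩‖₊ : ℝ≥0∞) ^ 2 * prodWeight (fun x => (q x + r x)⁻¹) ⟨n + 1, x⟩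
      ≤ ∑ i : Fin (n + 1), (‖f (x i)‖₊ : ℝ≥0∞) ^ 2 / (r (x i) : ℝ≥0∞) *
          ((‖χ ⟨n, x ∘ i.succAbove⟩‖₊ : ℝ≥0∞) ^ 2 *
            prodWeight (fun x => (q x)⁻¹) ⟨n, x ∘ i.succAbove⟩) := by
  set w : Fin (n + 1) → ℝ≥0 := fun i => r (x i) * ∏ j, q (x (i.succAbove j)) with hw
  have w_pos : ∀ i, 0 < w i := fun i => mul_pos (hr _) (Finset.prod_pos fun j _ => hq _)
  set a : Fin (n + 1) → ℝ≥0 := fun i => ‖f (x i)‖₊ * ‖χ ⟨n, x ∘ i.succAbove⟩‖₊ with ha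
  have hnorm : ‖creation f χ ⟨n + 1, x⟩‖₊ ≤ ∑ i, a i :=
    (nnnorm_sum_le _ _).trans_eq (Finset.sum_congr rfl fun i _ => nnnorm_smul _ _)
  have hsum : ∑ i, w i ≤ ∏ j, (q (x j) + r (x j)) :=
    sum_mul_prod_succAbove_le_prod_add n (fun i => q (x i)) (fun i => r (x i))
  have hsum_pos : 0 < ∑ i, w i := Finset.sum_pos (fun i _ => w_pos i) Finset.univ_nonempty
  have key : ‖creation f χ ⟨n + 1, x⟩‖₊ ^ 2 * ∏ j, (q (x j) + r (x j))⁻¹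
      ≤ ∑ i, ‖f (x i)‖₊ ^ 2 / r (x i) *
          (‖χ ⟨n, x ∘ i.succAbove⟩‖₊ ^ 2 * ∏ j, (q (x (i.succAbove j)))⁻¹) := by
    calc ‖creation f χ ⟨n + 1, x⟩‖₊ ^ 2 * ∏ j, (q (x j) + r (x j))⁻¹
        ≤ (∑ i, a i) ^ 2 / ∑ i, w i := by
          rw [Finset.prod_inv_distrib, div_eq_mul_inv]
          gcongr
      _ ≤ ∑ i, a i ^ 2 / w i := Finset.sq_sum_div_le_sum_sq_div _ _ fun i _ => w_pos i
      _ = _ := by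
          refine Finset.sum_congr rfl fun i _ => ?_
          simp only [ha, hw, Finset.prod_inv_distrib, div_eq_mul_inv, mul_inv, mul_pow]
          ring
  have key' := ENNReal.coe_le_coe.2 key
  push_cast [ENNReal.coe_div (hr _).ne'] at key'
  exact key'

theorem lintegral_pi_mul_succAbove {X : Type*} [MeasurableSpace X] (lam : Measure X)
    [SigmaFinite lam] (n : ℕ) (i : Fin (n + 1)) {g : X → ℝ≥0∞} (hg : Measurable g)
    {G : (Fin n → X) → ℝ≥0∞} (hG : Measurable G) :
    ∫⁻ x : Fin (n + 1) → X, g (x i) * G (x ∘ i.succAbove) ∂(Measure.pi fun _ => lam)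
      = (∫⁻ x, g x ∂lam) * ∫⁻ y, G y ∂(Measure.pi fun _ => lam) := by
  rw [← lintegral_prod_mul hg.aemeasurable hG.aemeasurable,
    ← (measurePreserving_piFinSuccAbove (fun _ : Fin (n + 1) => lam) i).lintegral_comp
      (by fun_prop)]
  rfl

theorem lintegral_pi_sum_mul_succAbove {X : Type*} [MeasurableSpace X] (lam : Measure X)
    [SigmaFinite lam] (n : ℕ) {g : X → ℝ≥0∞} (hg : Measurable g)
    {G : (Fin n → X) → ℝ≥0∞} (hG : Measurable G) :
    ∫⁻ x : Fin (n + 1) → X, ∑ i, g (x i) * G (x ∘ i.succAbove) ∂(Measure.pi fun _ => lam)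
      = ((n + 1 : ℕ) : ℝ≥0∞) *
          ((∫⁻ x, g x ∂lam) * ∫⁻ y, G y ∂(Measure.pi fun _ => lam)) := by
  have hmeas (i : Fin (n + 1)) :
      Measurable fun x : Fin (n + 1) → X => g (x i) * G (x ∘ i.succAbove) :=
    (hg.comp (measurable_pi_apply i)).mul
      (hG.comp (measurable_pi_lambda _ fun j => measurable_pi_apply (i.succAbove j)))
  rw [lintegral_finsetSum _ fun i _ => hmeas i,
    Finset.sum_congr rfl fun i _ => lintegral_pi_mul_succAbove lam n i hg hG,
    Finset.sum_const, Finset.card_univ, Fintype.card_fin, nsmul_eq_mul]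

theorem measurable_sigmaMk_fin {X : Type*} [MeasurableSpace X] (n : ℕ) :
    Measurable (fun x : Fin n → X => (⟨n, x⟩ : GS X)) :=
  measurable_iff_le_map.2 (iInf_le _ n)

theorem measurable_prodWeight_mk {X : Type*} [MeasurableSpace X] {q : X → ℝ≥0}
    (hq : Measurable q) (n : ℕ) :
    Measurable fun x : Fin n → X => prodWeight q ⟨n, x⟩ := by
  have h : Measurable fun x : Fin n → X => ∏ i, (q (x i) : ℝ≥0∞) :=
    Finset.measurable_fun_prod _ fun i _ => (hq.comp (measurable_pi_apply i)).coe_nnreal_ennreal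
  exact h

theorem lintegral_guichardetMeasure_le {X : Type*} [MeasurableSpace X] (lam : Measure X)
    (F : GS X → ℝ≥0∞) :
    ∫⁻ ϑ, F ϑ ∂(guichardetMeasure lam)
      ≤ ∑' n : ℕ, ((n.factorial : ℝ≥0∞))⁻¹ *
          ∫⁻ x : Fin n → X, F ⟨n, x⟩ ∂(Measure.pi fun _ => lam) := by
  rw [guichardetMeasure, lintegral_sum_measure]
  refine ENNReal.tsum_le_tsum fun n => ?_
  rw [lintegral_smul_measure, smul_eq_mul]
  gcongr
  exact lintegral_map_le _ _

theorem lintegral_guichardetMeasure {X : Type*} [MeasurableSpace X] (lam : Measure X)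
    {F : GS X → ℝ≥0∞} (hF : Measurable F) :
    ∫⁻ ϑ, F ϑ ∂(guichardetMeasure lam)
      = ∑' n : ℕ, ((n.factorial : ℝ≥0∞))⁻¹ *
          ∫⁻ x : Fin n → X, F ⟨n, x⟩ ∂(Measure.pi fun _ => lam) := by
  rw [guichardetMeasure, lintegral_sum_measure]
  refine tsum_congr fun n => ?_
  rw [lintegral_smul_measure, smul_eq_mul, lintegral_map hF (measurable_sigmaMk_fin n)]

theorem measurable_prodWeight {X : Type*} [MeasurableSpace X] {q : X → ℝ≥0}
    (hq : Measurable q) : Measurable (prodWeight q) := by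
  intro s hs
  exact MeasurableSpace.measurableSet_iInf.2 fun n => measurable_prodWeight_mk hq n hs

/-- The creation estimate
`∫ ‖a*(f)χ‖² ((q+r)⁻¹)^⊗ dμ ≤ (∫ |f|²/r dλ) · ∫ ‖χ‖² (q⁻¹)^⊗ dμ`. -/
theorem stmt10 {X : Type*} [MeasurableSpace X] (lam : Measure X) [SigmaFinite lam]
    {H : Type*} [NormedAddCommGroup H] [InnerProductSpace ℂ H] [MeasurableSpace H] [BorelSpace H]
    (f : X → ℂ) (hf : Measurable f)
    (q : X → ℝ≥0) (hq : Measurable q) (hqpos : ∀ x, 0 < q x)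
    (r : X → ℝ≥0) (hr : Measurable r) (hrpos : ∀ x, 0 < r x)
    (χ : GS X → H) (hχ : Measurable χ) (hχs : SymmFun χ) :
    ∫⁻ ϑ : GS X, (‖creation f χ ϑ‖₊ : ℝ≥0∞) ^ 2 * prodWeight (fun x => (q x + r x)⁻¹) ϑ
        ∂(guichardetMeasure lam)
      ≤ (∫⁻ x, (‖f x‖₊ : ℝ≥0∞) ^ 2 / (r x : ℝ≥0∞) ∂lam) *
          ∫⁻ ϑ : GS X, (‖χ ϑ‖₊ : ℝ≥0∞) ^ 2 * prodWeight (fun x => (q x)⁻¹) ϑ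
            ∂(guichardetMeasure lam) := by
  have hqi : Measurable fun x => (q x)⁻¹ := hq.inv
  have hg : Measurable fun x => (‖f x‖₊ : ℝ≥0∞) ^ 2 / (r x : ℝ≥0∞) := by fun_prop
  have hF : Measurable fun ϑ : GS X =>
      (‖χ ϑ‖₊ : ℝ≥0∞) ^ 2 * prodWeight (fun x => (q x)⁻¹) ϑ :=
    (hχ.nnnorm.coe_nnreal_ennreal.pow_const 2).mul (measurable_prodWeight hqi)
  refine (lintegral_guichardetMeasure_le lam _).trans ?_
  rw [lintegral_guichardetMeasure lam hF, tsum_eq_zero_add' ENNReal.summable,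
    ← ENNReal.tsum_mul_left]
  have h_zero (x : Fin 0 → X) : creation f χ ⟨0, x⟩ = 0 := by simp [creation]
  simp only [h_zero, nnnorm_zero, ENNReal.coe_zero, ne_eq, OfNat.ofNat_ne_zero,
    not_false_eq_true, zero_pow, zero_mul, lintegral_zero, mul_zero, zero_add]
  refine ENNReal.tsum_le_tsum fun n => ?_
  have hFn := hF.comp (measurable_sigmaMk_fin n)
  have hfact : (((n + 1).factorial : ℕ) : ℝ≥0∞)⁻¹ * ((n + 1 : ℕ) : ℝ≥0∞)
      = ((n.factorial : ℕ) : ℝ≥0∞)⁻¹ := by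
    rw [Nat.factorial_succ, Nat.cast_mul,
      ENNReal.mul_inv (Or.inr (natCast_ne_top _)) (Or.inl (natCast_ne_top _)), mul_right_comm,
      ENNReal.inv_mul_cancel (Nat.cast_ne_zero.2 n.succ_ne_zero) (natCast_ne_top _), one_mul]
  refine (mul_le_mul_right (lintegral_mono fun x =>
    creation_sq_mul_prodWeight_le f q r hqpos hrpos χ n x) _).trans_eq ?_
  refine (congrArg _ (lintegral_pi_sum_mul_succAbove lam n hg hFn)).trans ?_
  rw [← mul_assoc, hfact, mul_left_comm]
  rfl
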